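/- arXiv:1801.08960 — 2 statements merged into one kernel-verified Lean document; each statement's English description precedes it below -/
import Mathlib

section
/- Under hypotheses (P1)–(P3) and Kγ/α < 1, the maps H(t,·) and G(t,·) are mutually inverse bijections of ℝⁿ for every fixed t ≥ 0: H(t, G(t,η)) = η and G(t, H(t,ξ)) = ξ for all ξ, η ∈ ℝⁿ. -/
open Real MeasureTheory Filter Topology

section aux
variable {E : Type*} [NormedAddCommGroup E] [NormedSpace ℝ E] [FiniteDimensional ℝ E]

theorem aux_apply_inv {Φ : ℝ → ℝ → (E →L[ℝ] E)}
    (hid : ∀ s, Φ s s = ContinuousLinearMap.id ℝ E)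
    (hcoc : ∀ t s r, (Φ t s).comp (Φ s r) = Φ t r) (t s r : ℝ) (v : E) :
    Φ t s (Φ s r v) = Φ t r v := by
  rw [← hcoc t s r]; rfl

theorem aux_cont_fst {A : ℝ → E →L[ℝ] E} {Φ : ℝ → ℝ → (E →L[ℝ] E)}
    (hd : ∀ s ξ t, HasDerivAt (fun r => Φ r s ξ) (A t (Φ t s ξ)) t) (s : ℝ) :
    Continuous (fun r => Φ r s) := by
  rw [continuous_clm_apply]
  intro v
  exact continuous_iff_continuousAt.2 fun t => (hd s v t).continuousAt

theorem aux_cont_snd {A : ℝ → E →L[ℝ] E} {Φ : ℝ → ℝ → (E →L[ℝ] E)}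
    (hid : ∀ s, Φ s s = ContinuousLinearMap.id ℝ E)
    (hcoc : ∀ t s r, (Φ t s).comp (Φ s r) = Φ t r)
    (hd : ∀ s ξ t, HasDerivAt (fun r => Φ r s ξ) (A t (Φ t s ξ)) t) (s : ℝ) :
    Continuous (fun r => Φ s r) := by
  have : CompleteSpace E := FiniteDimensional.complete ℝ E
  let u : ℝ → (E →L[ℝ] E)ˣ := fun r =>
    ⟨Φ r s, Φ s r, by rw [ContinuousLinearMap.mul_def, hcoc, hid]; rfl,
      by rw [ContinuousLinearMap.mul_def, hcoc, hid]; rfl⟩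
  have h1 : (fun r => Φ s r) = fun r => Ring.inverse (Φ r s) := by
    funext r
    exact (Ring.inverse_unit (u r)).symm
  rw [h1]
  refine continuous_iff_continuousAt.2 fun r => ?_
  exact ContinuousAt.comp (f := fun r => Φ r s) (NormedRing.inverse_continuousAt (u r))
    (aux_cont_fst hd s).continuousAt

theorem aux_deriv {A : ℝ → E →L[ℝ] E} {Φ : ℝ → ℝ → (E →L[ℝ] E)}
    (hd : ∀ s ξ t, HasDerivAt (fun r => Φ r s ξ) (A t (Φ t s ξ)) t)
    {q : ℝ → E} {q' : E} {t : ℝ} (hq : HasDerivAt q q' t) :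
    HasDerivAt (fun r => Φ r 0 (q r)) (A t (Φ t 0 (q t)) + Φ t 0 q') t := by
  let b := Module.finBasis ℝ E
  let c : ∀ i, E →L[ℝ] ℝ := fun i => LinearMap.toContinuousLinearMap (b.coord i)
  have hrep : ∀ v : E, v = ∑ i, c i v • b i := fun v => (b.sum_repr v).symm
  have hfun : (fun r => Φ r 0 (q r)) = fun r => ∑ i, c i (q r) • Φ r 0 (b i) := by
    funext r
    conv_lhs => rw [hrep (q r)]
    simp only [map_sum, map_smul]
  rw [hfun]
  have h2 : HasDerivAt (fun r => ∑ i, c i (q r) • Φ r 0 (b i))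
      (∑ i, (c i (q t) • A t (Φ t 0 (b i)) + c i q' • Φ t 0 (b i))) t := by
    refine HasDerivAt.fun_sum fun i _ => ?_
    exact ((c i).hasFDerivAt.comp_hasDerivAt t hq).smul (hd 0 (b i) t)
  convert h2 using 1
  rw [Finset.sum_add_distrib]
  conv_lhs => rw [hrep q', hrep (q t)]
  simp only [map_sum, map_smul]

theorem aux_voc {A : ℝ → E →L[ℝ] E} {Φ : ℝ → ℝ → (E →L[ℝ] E)}
    (hid : ∀ s, Φ s s = ContinuousLinearMap.id ℝ E)
    (hcoc : ∀ t s r, (Φ t s).comp (Φ s r) = Φ t r)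
    (hd : ∀ s ξ t, HasDerivAt (fun r => Φ r s ξ) (A t (Φ t s ξ)) t)
    {h : ℝ → E} (hh : Continuous h) (c : E) (t : ℝ) :
    HasDerivAt (fun s => Φ s 0 (c + ∫ r in (0:ℝ)..s, Φ 0 r (h r)))
      (A t (Φ t 0 (c + ∫ r in (0:ℝ)..t, Φ 0 r (h r))) + h t) t := by
  have : CompleteSpace E := FiniteDimensional.complete ℝ E
  have hg : Continuous fun r => Φ 0 r (h r) := (aux_cont_snd hid hcoc hd 0).clm_apply hh
  have hq : HasDerivAt (fun s => c + ∫ r in (0:ℝ)..s, Φ 0 r (h r)) (Φ 0 t (h t)) t :=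
    (intervalIntegral.integral_hasDerivAt_right (hg.intervalIntegrable _ _)
      (hg.stronglyMeasurableAtFilter _ _) hg.continuousAt).const_add c
  have := aux_deriv hd hq
  rw [aux_apply_inv hid hcoc, hid] at this
  exact this

theorem aux_int_comm {Φ : ℝ → ℝ → (E →L[ℝ] E)}
    (hid : ∀ s, Φ s s = ContinuousLinearMap.id ℝ E)
    (hcoc : ∀ t s r, (Φ t s).comp (Φ s r) = Φ t r) (h : ℝ → E) (t a b : ℝ) :
    ∫ s in a..b, Φ t s (h s) = Φ t 0 (∫ s in a..b, Φ 0 s (h s)) := by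
  let L : E ≃L[ℝ] E := ContinuousLinearEquiv.equivOfInverse (Φ t 0) (Φ 0 t)
    (fun x => by rw [aux_apply_inv hid hcoc, hid]; rfl)
    (fun x => by rw [aux_apply_inv hid hcoc, hid]; rfl)
  have hL : ∀ x, Φ t 0 x = L x := fun x => rfl
  have h1 : ∀ s, Φ t s (h s) = L (Φ 0 s (h s)) := fun s => by
    rw [← hL, aux_apply_inv hid hcoc]
  simp only [h1, hL, intervalIntegral, map_sub, L.integral_comp_comm]

theorem aux_unique {A : ℝ → E →L[ℝ] E} {f : ℝ → E → E} {M γ T : ℝ} (hM : 0 < M) (hγ : 0 < γ)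
    (hA : ∀ t, 0 ≤ t → ‖A t‖ ≤ M)
    (hflip : ∀ t u v, 0 ≤ t → ‖f t u - f t v‖ ≤ γ * ‖u - v‖)
    {p q : ℝ → E}
    (hp : ∀ t, 0 ≤ t → HasDerivAt p (A t (p t) + f t (p t)) t)
    (hq : ∀ t, 0 ≤ t → HasDerivAt q (A t (q t) + f t (q t)) t)
    (h : p 0 = q 0 ∨ p T = q T) : Set.EqOn p q (Set.Icc 0 T) := by
  have hl : ∀ t, 0 ≤ t → LipschitzOnWith (M + γ).toNNReal (fun x => A t x + f t x) Set.univ := by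
    intro t ht
    refine LipschitzOnWith.of_dist_le_mul fun x _ y _ => ?_
    rw [Real.coe_toNNReal _ (by positivity), dist_eq_norm, dist_eq_norm]
    calc ‖A t x + f t x - (A t y + f t y)‖ = ‖A t (x - y) + (f t x - f t y)‖ := by
          rw [map_sub]; congr 1; abel
      _ ≤ ‖A t (x - y)‖ + ‖f t x - f t y‖ := norm_add_le _ _
      _ ≤ M * ‖x - y‖ + γ * ‖x - y‖ := by
          gcongr
          · exact (A t).le_of_opNorm_le (hA t ht) _
          · exact hflip t x y ht
      _ = _ := by ring
  have cp : ContinuousOn p (Set.Icc 0 T) := fun t ht =>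
    (hp t ht.1).continuousAt.continuousWithinAt
  have cq : ContinuousOn q (Set.Icc 0 T) := fun t ht =>
    (hq t ht.1).continuousAt.continuousWithinAt
  rcases h with h | h
  · exact ODE_solution_unique_of_mem_Icc_right (v := fun t x => A t x + f t x)
      (s := fun _ => Set.univ) (fun t ht => hl t ht.1) cp
      (fun t ht => (hp t ht.1).hasDerivWithinAt) (fun _ _ => trivial) cq
      (fun t ht => (hq t ht.1).hasDerivWithinAt) (fun _ _ => trivial) h
  · exact ODE_solution_unique_of_mem_Icc_left (v := fun t x => A t x + f t x)
      (s := fun _ => Set.univ) (fun t ht => hl t ht.1.le) cp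
      (fun t ht => (hp t ht.1.le).hasDerivWithinAt) (fun _ _ => trivial) cq
      (fun t ht => (hq t ht.1.le).hasDerivWithinAt) (fun _ _ => trivial) h

/-- Any solution of the fixed point equation is continuous on the half line. -/
theorem aux_zcont {A : ℝ → E →L[ℝ] E} {Φ : ℝ → ℝ → (E →L[ℝ] E)}
    (hid : ∀ s, Φ s s = ContinuousLinearMap.id ℝ E)
    (hcoc : ∀ t s r, (Φ t s).comp (Φ s r) = Φ t r)
    (hd : ∀ s ξ t, HasDerivAt (fun r => Φ r s ξ) (A t (Φ t s ξ)) t)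
    {f : ℝ → E → E} {μ : ℝ}
    (hfcont : Continuous fun p : ℝ × E => f p.1 p.2)
    (hfbdd : ∀ t u, 0 ≤ t → ‖f t u‖ ≤ μ)
    {k z : ℝ → E} (hk : Continuous k)
    (hz : ∀ t, 0 ≤ t → z t = ∫ s in (0:ℝ)..t, Φ t s (f s (k s + z s))) :
    ContinuousOn z (Set.Ici 0) := by
  have : CompleteSpace E := FiniteDimensional.complete ℝ E
  have c1 := aux_cont_fst hd 0
  have c2 := aux_cont_snd hid hcoc hd 0
  set g : ℝ → E := fun s => Φ 0 s (f s (k s + z s)) with hg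
  have hz' : ∀ t, 0 ≤ t → z t = Φ t 0 (∫ s in (0:ℝ)..t, g s) := fun t ht => by
    rw [hz t ht, aux_int_comm hid hcoc]
  have hc : ∀ c, 0 ≤ c → IntervalIntegrable g volume 0 c → ContinuousOn z (Set.Icc 0 c) := by
    intro c hc0 hi
    have h1 := intervalIntegral.continuousOn_primitive_interval' hi Set.left_mem_uIcc
    rw [Set.uIcc_of_le hc0] at h1
    exact (c1.continuousOn.clm_apply h1).congr fun t ht => hz' t ht.1
  have hgc : ∀ {w : ℝ → E} {s : Set ℝ}, ContinuousOn w s →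
      ContinuousOn (fun s => Φ 0 s (f s (k s + w s))) s := by
    intro w s hw
    refine c2.continuousOn.clm_apply ?_
    exact hfcont.comp_continuousOn (continuousOn_id.prodMk (hk.continuousOn.add hw))
  have key : ∀ b, 0 ≤ b → IntervalIntegrable g volume 0 b := by
    intro b hb
    by_contra hnb
    let S : Set ℝ := {c | 0 ≤ c ∧ IntervalIntegrable g volume 0 c}
    have hmono : ∀ c ∈ S, ∀ d, 0 ≤ d → d ≤ c → IntervalIntegrable g volume 0 d := by
      intro c hcS d h0 hdc
      refine hcS.2.mono_set ?_
      rw [Set.uIcc_of_le h0, Set.uIcc_of_le hcS.1]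
      exact Set.Icc_subset_Icc_right hdc
    have hub : ∀ c ∈ S, c ≤ b := by
      intro c hcS
      by_contra hlt
      exact hnb (hmono c hcS b hb (not_le.1 hlt).le)
    have hS0 : (0:ℝ) ∈ S := ⟨le_rfl, by simp⟩
    have hbdd : BddAbove S := ⟨b, hub⟩
    set T := sSup S with hT
    have hT0 : 0 ≤ T := le_csSup hbdd hS0
    have hTb : T ≤ b := csSup_le ⟨0, hS0⟩ hub
    have hzT : ContinuousOn z (Set.Ioo 0 T) := by
      intro x hx
      obtain ⟨c, hcS, hxc⟩ := exists_lt_of_lt_csSup ⟨0, hS0⟩ hx.2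
      exact ((hc c hcS.1 hcS.2).continuousAt (Icc_mem_nhds hx.1 hxc)).continuousWithinAt
    have hTS : IntervalIntegrable g volume 0 T := by
      rw [intervalIntegrable_iff_integrableOn_Ioo_of_le hT0]
      obtain ⟨C, hC⟩ := (isCompact_Icc (a := (0:ℝ)) (b := T)).exists_bound_of_continuousOn
        c2.continuousOn
      refine IntegrableOn.of_bound (C := C * μ) (by simp)
        ((hgc hzT).aestronglyMeasurable measurableSet_Ioo) ?_
      refine (ae_restrict_mem measurableSet_Ioo).mono fun x hx => ?_
      have hx' : x ∈ Set.Icc 0 T := ⟨hx.1.le, hx.2.le⟩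
      have hC0 := hC x hx'
      calc ‖Φ 0 x (f x (k x + z x))‖ ≤ C * ‖f x (k x + z x)‖ :=
            (Φ 0 x).le_of_opNorm_le hC0 _
        _ ≤ C * μ := by
            have := (norm_nonneg _).trans hC0
            gcongr
            exact hfbdd x _ hx.1.le
    have hTb2 : IntervalIntegrable g volume T b := by
      have h0 : Continuous (fun s => Φ 0 s (f s (k s + (fun _ => (0:E)) s))) := by
        have := hgc (w := fun _ => (0:E)) (s := Set.univ) continuousOn_const
        exact continuousOn_univ.1 this
      refine (h0.intervalIntegrable T b).congr ?_
      intro x hx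
      rw [Set.uIoc_of_le hTb] at hx
      have hx0 : 0 ≤ x := hT0.trans hx.1.le
      have hn : ¬ IntervalIntegrable g volume 0 x := fun hi =>
        absurd (le_csSup hbdd (show x ∈ S from ⟨hx0, hi⟩)) (not_le.2 hx.1)
      have : z x = 0 := by
        rw [hz' x hx0, intervalIntegral.integral_undef hn, map_zero]
      simp only [hg, this]
    exact hnb (hTS.trans hTb2)
  intro x hx
  have h1 : ContinuousWithinAt z (Set.Icc 0 (x+1)) x :=
    hc (x+1) (by linarith [Set.mem_Ici.1 hx]) (key _ (by linarith [Set.mem_Ici.1 hx])) x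
      ⟨hx, by linarith⟩
  refine h1.mono_of_mem_nhdsWithin ?_
  rw [← Set.Ici_inter_Iic]
  exact inter_mem_nhdsWithin _ (Iic_mem_nhds (by linarith))

theorem aux_cont_max {w : ℝ → E} (hw : ContinuousOn w (Set.Ici 0)) :
    Continuous fun s => w (max s 0) :=
  hw.comp_continuous (by fun_prop) fun s => le_max_right s 0

end aux

theorem stmt5 (n : ℕ) (K α γ μ M : ℝ)
    (hK : 1 ≤ K) (hα : 0 < α) (hγ : 0 < γ) (hμ : 0 < μ) (hM : 0 < M)
    (A : ℝ → (EuclideanSpace ℝ (Fin n)) →L[ℝ] (EuclideanSpace ℝ (Fin n)))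
    (hAcont : Continuous A) (hAbdd : ∀ t, 0 ≤ t → ‖A t‖ ≤ M)
    (Φ : ℝ → ℝ → ((EuclideanSpace ℝ (Fin n)) →L[ℝ] (EuclideanSpace ℝ (Fin n))))
    (hΦid : ∀ s, Φ s s = ContinuousLinearMap.id ℝ (EuclideanSpace ℝ (Fin n)))
    (hΦderiv : ∀ s ξ t, HasDerivAt (fun r => Φ r s ξ) (A t (Φ t s ξ)) t)
    (hΦcocycle : ∀ t s r, (Φ t s).comp (Φ s r) = Φ t r)
    (hΦdecay : ∀ s t, 0 ≤ s → s ≤ t → ‖Φ t s‖ ≤ K * Real.exp (-α * (t - s)))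
    (f : ℝ → (EuclideanSpace ℝ (Fin n)) → (EuclideanSpace ℝ (Fin n)))
    (hfcont : Continuous fun p : ℝ × (EuclideanSpace ℝ (Fin n)) => f p.1 p.2)
    (hflip : ∀ t u v, 0 ≤ t → ‖f t u - f t v‖ ≤ γ * ‖u - v‖)
    (hfbdd : ∀ t u, 0 ≤ t → ‖f t u‖ ≤ μ)
    (hsmall : K * γ / α < 1)
    (y : ℝ → (EuclideanSpace ℝ (Fin n)) → ℝ → (EuclideanSpace ℝ (Fin n)))
    (hyinit : ∀ τ η, y τ η τ = η)
    (hyderiv : ∀ τ η t, 0 ≤ t → HasDerivAt (y τ η) (A t (y τ η t) + f t (y τ η t)) t)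
    (zstar : ℝ → (EuclideanSpace ℝ (Fin n)) → ℝ → (EuclideanSpace ℝ (Fin n)))
    (hz : ∀ τ ξ t, 0 ≤ t → zstar τ ξ t =
      ∫ s in (0:ℝ)..t, Φ t s (f s (Φ s τ ξ + zstar τ ξ s)))
    (hzbdd : ∀ τ ξ, ∃ C, ∀ t, 0 ≤ t → ‖zstar τ ξ t‖ ≤ C) :
    ∀ t, 0 ≤ t →
      (∀ η : (EuclideanSpace ℝ (Fin n)),
        (η - ∫ s in (0:ℝ)..t, Φ t s (f s (y t η s))) +
          zstar t (η - ∫ s in (0:ℝ)..t, Φ t s (f s (y t η s))) t = η) ∧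
      (∀ ξ : (EuclideanSpace ℝ (Fin n)),
        (ξ + zstar t ξ t) -
          ∫ s in (0:ℝ)..t, Φ t s (f s (y t (ξ + zstar t ξ t) s)) = ξ) := by
  have happ := aux_apply_inv hΦid hΦcocycle
  -- general extension of the forcing term
  have hext : ∀ w : ℝ → EuclideanSpace ℝ (Fin n), ContinuousOn w (Set.Ici 0) →
      ∀ c, ∃ p : ℝ → EuclideanSpace ℝ (Fin n),
        (∀ s, 0 ≤ s → p s = Φ s 0 c + ∫ r in (0:ℝ)..s, Φ s r (f r (w r))) ∧
        ∀ s, 0 ≤ s → HasDerivAt p (A s (p s) + f s (w s)) s := by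
    intro w hw c
    have hh : Continuous fun r : ℝ => f (max r 0) (w (max r 0)) :=
      hfcont.comp ((continuous_id.max continuous_const).prodMk (aux_cont_max hw))
    refine ⟨fun s => Φ s 0 (c + ∫ r in (0:ℝ)..s, Φ 0 r (f (max r 0) (w (max r 0)))),
      ?_, fun s hs => ?_⟩
    rotate_left
    · have := aux_voc hΦid hΦcocycle hΦderiv hh c s
      rw [max_eq_left hs] at this
      exact this
    · intro s hs
      simp only [map_add]
      congr 1
      rw [← aux_int_comm hΦid hΦcocycle]
      refine intervalIntegral.integral_congr fun r hr => ?_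
      rw [Set.uIcc_of_le hs] at hr
      simp only [max_eq_left hr.1]
  have hX : ∀ τ ξ, ∃ p : ℝ → EuclideanSpace ℝ (Fin n),
      (∀ s, 0 ≤ s → p s = Φ s τ ξ + zstar τ ξ s) ∧
      ∀ s, 0 ≤ s → HasDerivAt p (A s (p s) + f s (p s)) s := by
    intro τ ξ
    have hk : Continuous fun s => Φ s τ ξ :=
      (aux_cont_fst hΦderiv τ).clm_apply continuous_const
    have hzc := aux_zcont hΦid hΦcocycle hΦderiv hfcont hfbdd hk (hz τ ξ)
    obtain ⟨p, hp1, hp2⟩ := hext (fun s => Φ s τ ξ + zstar τ ξ s) (hk.continuousOn.add hzc)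
      (Φ 0 τ ξ)
    have hp3 : ∀ s, 0 ≤ s → p s = Φ s τ ξ + zstar τ ξ s := by
      intro s hs
      rw [hp1 s hs, happ, hz τ ξ s hs]
    refine ⟨p, hp3, fun s hs => ?_⟩
    have := hp2 s hs
    rwa [← hp3 s hs] at this
  have hY : ∀ τ η t, 0 ≤ t → y τ η t = Φ t 0 (y τ η 0) +
      ∫ s in (0:ℝ)..t, Φ t s (f s (y τ η s)) := by
    intro τ η t ht
    obtain ⟨p, hp1, hp2⟩ := hext (y τ η)
      (fun s hs => (hyderiv τ η s hs).continuousAt.continuousWithinAt) (y τ η 0)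
    rw [← hp1 t ht]
    refine aux_unique (f := fun s _ => f s (y τ η s)) (T := t) hM hγ hAbdd ?_
      (hyderiv τ η) hp2 (Or.inl ?_) ⟨ht, le_rfl⟩
    · intro s u v hs
      simp only [sub_self, norm_zero]
      positivity
    · rw [hp1 0 le_rfl, hΦid]
      simp
  intro t ht
  constructor
  · intro η
    have h1 := hY t η t ht
    rw [hyinit] at h1
    have h2 : η - ∫ s in (0:ℝ)..t, Φ t s (f s (y t η s)) = Φ t 0 (y t η 0) :=
      sub_eq_of_eq_add h1
    rw [h2]
    obtain ⟨p, hp1, hp2⟩ := hX t (Φ t 0 (y t η 0))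
    have h3 : p 0 = y t η 0 := by
      rw [hp1 0 le_rfl, happ, hΦid, hz _ _ 0 le_rfl]
      simp
    have h4 := aux_unique (T := t) hM hγ hAbdd hflip hp2 (hyderiv t η) (Or.inl h3) ⟨ht, le_rfl⟩
    rw [hp1 t ht, hyinit, happ] at h4
    exact h4
  · intro ξ
    obtain ⟨p, hp1, hp2⟩ := hX t ξ
    have h3 : p t = y t (ξ + zstar t ξ t) t := by
      rw [hp1 t ht, hyinit, hΦid]
      rfl
    have h4 := aux_unique (T := t) hM hγ hAbdd hflip hp2 (hyderiv t (ξ + zstar t ξ t)) (Or.inr h3)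
    have h5 : ∫ s in (0:ℝ)..t, Φ t s (f s (y t (ξ + zstar t ξ t) s)) = zstar t ξ t := by
      rw [hz t ξ t ht]
      refine intervalIntegral.integral_congr fun s hs => ?_
      rw [Set.uIcc_of_le ht] at hs
      have h6 := h4 hs
      rw [hp1 s hs.1] at h6
      rw [← hz t ξ t ht]
      simp only [← h6]
    rw [h5]
    abel
end

section
/- Under the hypotheses of Theorem 1 (strong topological equivalence on ℝ⁺), the map G satisfies |G(t,η) − G(t,η̄)| ≤ C(t)|η − η̄| for all t ≥ 0, where C(t) = 1 + Kγ(1 − e^{(−α+M+γ)t})/(α − M − γ) if α ≠ M + γ, and C(t) = 1 + Kγt if α = M + γ. -/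
open Real MeasureTheory Filter Topology

theorem stmt8 (n : ℕ) (K α γ μ M : ℝ)
    (hK : 1 ≤ K) (hα : 0 < α) (hγ : 0 < γ) (hμ : 0 < μ) (hM : 0 < M)
    (A : ℝ → (EuclideanSpace ℝ (Fin n)) →L[ℝ] (EuclideanSpace ℝ (Fin n)))
    (hAcont : Continuous A) (hAbdd : ∀ t, 0 ≤ t → ‖A t‖ ≤ M)
    (Φ : ℝ → ℝ → ((EuclideanSpace ℝ (Fin n)) →L[ℝ] (EuclideanSpace ℝ (Fin n))))
    (hΦid : ∀ s, Φ s s = ContinuousLinearMap.id ℝ (EuclideanSpace ℝ (Fin n)))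
    (hΦderiv : ∀ s ξ t, HasDerivAt (fun r => Φ r s ξ) (A t (Φ t s ξ)) t)
    (hΦcocycle : ∀ t s r, (Φ t s).comp (Φ s r) = Φ t r)
    (hΦdecay : ∀ s t, 0 ≤ s → s ≤ t → ‖Φ t s‖ ≤ K * Real.exp (-α * (t - s)))
    (f : ℝ → (EuclideanSpace ℝ (Fin n)) → (EuclideanSpace ℝ (Fin n)))
    (hfcont : Continuous fun p : ℝ × (EuclideanSpace ℝ (Fin n)) => f p.1 p.2)
    (hflip : ∀ t u v, 0 ≤ t → ‖f t u - f t v‖ ≤ γ * ‖u - v‖)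
    (hfbdd : ∀ t u, 0 ≤ t → ‖f t u‖ ≤ μ)
    (hsmall : K * γ / α < 1)
    (y : ℝ → (EuclideanSpace ℝ (Fin n)) → ℝ → (EuclideanSpace ℝ (Fin n)))
    (hyinit : ∀ τ η, y τ η τ = η)
    (hyderiv : ∀ τ η t, 0 ≤ t → HasDerivAt (y τ η) (A t (y τ η t) + f t (y τ η t)) t) :
    ∀ t, 0 ≤ t → ∀ η η' : (EuclideanSpace ℝ (Fin n)),
      ‖(η - ∫ s in (0:ℝ)..t, Φ t s (f s (y t η s))) -
        (η' - ∫ s in (0:ℝ)..t, Φ t s (f s (y t η' s)))‖ ≤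
      (if α = M + γ then 1 + K * γ * t
        else 1 + K * γ * (1 - Real.exp ((-α + M + γ) * t)) / (α - M - γ)) * ‖η - η'‖ := by
  intro t ht η η'
  have hcont : ∀ ζ, ContinuousOn (fun s => Φ t s (f s (y t ζ s))) (Set.Icc 0 t) := by
    intro ζ s₀ hs₀
    have hw : ContinuousAt (fun s => f s (y t ζ s)) s₀ := by
      have h1 : ContinuousAt (y t ζ) s₀ := (hyderiv t ζ s₀ hs₀.1).continuousAt
      exact (hfcont.continuousAt (x := (s₀, y t ζ s₀))).comp
        (f := fun s => (s, y t ζ s)) (continuousAt_id.prodMk h1)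
    have hz : Tendsto (fun s => K * ‖f s (y t ζ s) - Φ s s₀ (f s₀ (y t ζ s₀))‖) (𝓝 s₀) (𝓝 0) := by
      have h2 : ContinuousAt (fun s => Φ s s₀ (f s₀ (y t ζ s₀))) s₀ :=
        (hΦderiv s₀ _ s₀).continuousAt
      have h3 : ContinuousAt
          (fun s => K * ‖f s (y t ζ s) - Φ s s₀ (f s₀ (y t ζ s₀))‖) s₀ :=
        continuousAt_const.mul (hw.sub h2).norm
      have h4 := h3.tendsto
      simpa [hΦid] using h4
    rw [ContinuousWithinAt, tendsto_iff_norm_sub_tendsto_zero]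
    refine squeeze_zero' (Eventually.of_forall fun _ => norm_nonneg _) ?_
      (hz.mono_left nhdsWithin_le_nhds)
    filter_upwards [self_mem_nhdsWithin] with s hs
    have h5 : Φ t s₀ (f s₀ (y t ζ s₀)) = Φ t s (Φ s s₀ (f s₀ (y t ζ s₀))) := by
      rw [← hΦcocycle t s s₀]; rfl
    rw [h5, ← map_sub]
    refine (ContinuousLinearMap.le_opNorm _ _).trans ?_
    refine mul_le_mul_of_nonneg_right ?_ (norm_nonneg _)
    refine (hΦdecay s t hs.1 hs.2).trans ?_
    have : Real.exp (-α * (t - s)) ≤ 1 := by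
      rw [Real.exp_le_one_iff]
      nlinarith [hs.2]
    nlinarith
  have hint : ∀ ζ, IntervalIntegrable (fun s => Φ t s (f s (y t ζ s))) volume 0 t := by
    intro ζ
    apply ContinuousOn.intervalIntegrable
    rw [Set.uIcc_of_le ht]
    exact hcont ζ
  have hgr : ∀ s ∈ Set.Icc 0 t,
      ‖y t η s - y t η' s‖ ≤ ‖η - η'‖ * Real.exp ((M + γ) * (t - s)) := by
    intro s hs
    have hd : ∀ r, r ≤ t → HasDerivAt (fun r => y t η (t - r) - y t η' (t - r))
        (-((A (t - r) (y t η (t - r)) + f (t - r) (y t η (t - r))) -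
          (A (t - r) (y t η' (t - r)) + f (t - r) (y t η' (t - r))))) r := by
      intro r hr
      have h := ((hyderiv t η (t - r) (by linarith)).sub
        (hyderiv t η' (t - r) (by linarith)))
      exact h.comp_const_sub t r
    have := norm_le_gronwallBound_of_norm_deriv_right_le (δ := ‖η - η'‖) (K := M + γ) (ε := 0)
      (a := 0) (b := t)
      (fun r hr => (hd r hr.2).continuousAt.continuousWithinAt)
      (fun r hr => (hd r hr.2.le).hasDerivWithinAt)
      (by simp [hyinit]) (fun r hr => by
        rw [norm_neg, add_sub_add_comm, ← map_sub, add_zero, add_mul]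
        have h0 : 0 ≤ t - r := by linarith [hr.2]
        refine (norm_add_le _ _).trans (add_le_add ?_ (hflip _ _ _ h0))
        exact (ContinuousLinearMap.le_opNorm _ _).trans
          (mul_le_mul_of_nonneg_right (hAbdd _ h0) (norm_nonneg _)))
      (t - s) ⟨by linarith [hs.2], by linarith [hs.1]⟩
    simpa [gronwallBound_ε0] using this
  have hI : ‖∫ s in (0:ℝ)..t, (Φ t s (f s (y t η s)) - Φ t s (f s (y t η' s)))‖ ≤
      ∫ s in (0:ℝ)..t, (K * γ * ‖η - η'‖) * Real.exp ((-α + M + γ) * (t - s)) := by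
    refine intervalIntegral.norm_integral_le_of_norm_le ht ?_
      (Continuous.intervalIntegrable (by fun_prop) _ _)
    refine Eventually.of_forall fun s hs => ?_
    have hs' : s ∈ Set.Icc 0 t := ⟨hs.1.le, hs.2⟩
    rw [← map_sub]
    calc _ ≤ ‖Φ t s‖ * ‖f s (y t η s) - f s (y t η' s)‖ := ContinuousLinearMap.le_opNorm _ _
      _ ≤ (K * Real.exp (-α * (t - s))) *
          (γ * (‖η - η'‖ * Real.exp ((M + γ) * (t - s)))) := by
        refine mul_le_mul (hΦdecay s t hs'.1 hs'.2) ?_ (norm_nonneg _) (by positivity)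
        exact (hflip s _ _ hs'.1).trans (mul_le_mul_of_nonneg_left (hgr s hs') hγ.le)
      _ = _ := by
        rw [show (-α + M + γ) * (t - s) = -α * (t - s) + (M + γ) * (t - s) by ring, Real.exp_add]
        ring
  rw [intervalIntegral.integral_sub (hint η) (hint η')] at hI
  have hN : ‖(η - ∫ s in (0:ℝ)..t, Φ t s (f s (y t η s))) -
        (η' - ∫ s in (0:ℝ)..t, Φ t s (f s (y t η' s)))‖ ≤ ‖η - η'‖ +
      ∫ s in (0:ℝ)..t, (K * γ * ‖η - η'‖) * Real.exp ((-α + M + γ) * (t - s)) := by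
    rw [sub_sub_sub_comm]
    exact (norm_sub_le _ _).trans (by linarith)
  refine hN.trans (le_of_eq ?_)
  rw [intervalIntegral.integral_const_mul]
  split_ifs with h
  · have h0 : -α + M + γ = 0 := by linarith
    simp [h0]
    ring
  · have h0 : -α + M + γ ≠ 0 := fun h' => h (by linarith)
    have h1 : α - M - γ ≠ 0 := fun h' => h (by linarith)
    have h2 : ∫ s in (0:ℝ)..t, Real.exp ((-α + M + γ) * (t - s)) =
        (1 - Real.exp ((-α + M + γ) * t)) / (α - M - γ) := by
      have hder : ∀ s ∈ Set.uIcc 0 t, HasDerivAt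
          (fun s => Real.exp ((-α + M + γ) * (t - s)) / (α - M - γ))
          (Real.exp ((-α + M + γ) * (t - s))) s := by
        intro s _
        have := ((((hasDerivAt_id s).const_sub t).const_mul (-α + M + γ)).exp).div_const (α - M - γ)
        refine HasDerivAt.congr_deriv this ?_
        simp only [id]
        rw [div_eq_iff h1]
        ring
      rw [intervalIntegral.integral_eq_sub_of_hasDerivAt hder
        (Continuous.intervalIntegrable (by fun_prop) _ _)]
      simp
      ring
    rw [h2]
    ring
end
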